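/- Let X and Y be free, identically distributed, with free Gamma distribution. Then X + Y and (X+Y)^{-1} X² (X+Y)^{-1} are NOT free. More precisely, R_2((1 + Y X^{-1})(1 + X^{-1} Y), X + Y) = 4λ²/(λ−1)^5 + 2(2λ−1)/(λ−1)^4 ≠ 0, where X^{-1} has free Poisson distribution with rate λ > 1 and jump size 1. -/

import Mathlib

open scoped Classical
open Finset

noncomputable section

namespace FreeProbLukacs

variable {A : Type*}

/-- Ordered (non-commutative) product of a tuple. -/
def tprod [Monoid A] {n : ℕ} (X : Fin n → A) : A := (List.ofFn X).prod

/-- `P` is a partition of `Fin n`: a finset of nonempty blocks, each point in a unique block. -/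
def IsPartition {n : ℕ} (P : Finset (Finset (Fin n))) : Prop :=
  (∀ B ∈ P, B.Nonempty) ∧ ∀ i : Fin n, ∃! B, B ∈ P ∧ i ∈ B

/-- `P` is non-crossing: there are no `a < b < c < d` with `a, c` in one block and
`b, d` in a different block. -/
def IsNonCrossing {n : ℕ} (P : Finset (Finset (Fin n))) : Prop :=
  ∀ B₁ ∈ P, ∀ B₂ ∈ P, ∀ a ∈ B₁, ∀ b ∈ B₂, ∀ c ∈ B₁, ∀ d ∈ B₂,
    a < b → b < c → c < d → B₁ = B₂

/-- The finset of all non-crossing partitions of `Fin n`. -/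
def NC (n : ℕ) : Finset (Finset (Finset (Fin n))) :=
  univ.filter fun P => IsPartition P ∧ IsNonCrossing P

/-- The cumulant functional `R` applied to the entries of `X` lying in a block `B`,
taken in increasing order of position. -/
def blockCum (R : ∀ n, (Fin n → A) → ℂ) {n : ℕ} (X : Fin n → A) (B : Finset (Fin n)) : ℂ :=
  R B.card fun j => X ((B.sort (· ≤ ·)).get (Fin.cast (Finset.length_sort (· ≤ ·)).symm j))

/-- Product of block cumulants over the blocks of a partition. -/
def partCum (R : ∀ n, (Fin n → A) → ℂ) {n : ℕ} (X : Fin n → A)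
    (P : Finset (Finset (Fin n))) : ℂ :=
  ∏ B ∈ P, blockCum R X B

/-- The moment–cumulant formula: `R` is the family of free cumulants of `φ`. -/
def MomentCumulant [Monoid A] (φ : A → ℂ) (R : ∀ n, (Fin n → A) → ℂ) : Prop :=
  ∀ (n : ℕ) (X : Fin n → A), φ (tprod X) = ∑ P ∈ NC n, partCum R X P

/-- Density of the absolutely continuous part of the Marchenko–Pastur law. -/
def freePoissonDensity (l a x : ℝ) : ℝ :=
  Real.sqrt (4 * l * a ^ 2 - (x - a * (1 + l)) ^ 2) / (2 * Real.pi * a * x)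

/-- The free Poisson (Marchenko–Pastur) distribution with rate `l` and jump size `a`. -/
def freePoissonMeasure (l a : ℝ) : MeasureTheory.Measure ℝ :=
  ENNReal.ofReal (max 0 (1 - l)) • MeasureTheory.Measure.dirac 0 +
    MeasureTheory.volume.withDensity fun x => ENNReal.ofReal (freePoissonDensity l a x)

/-- `X` has distribution `μ` in the sense of moments. -/
def HasMoments [Monoid A] (φ : A → ℂ) (X : A) (μ : MeasureTheory.Measure ℝ) : Prop :=
  ∀ r : ℕ, φ (X ^ r) = ((∫ t, t ^ r ∂μ : ℝ) : ℂ)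

/-- `φ` is a state: unital and positive. -/
def IsState [Ring A] [StarRing A] [Module ℂ A] (φ : A →ₗ[ℂ] ℂ) : Prop :=
  φ 1 = 1 ∧ ∀ a : A, ∃ r : ℝ, 0 ≤ r ∧ φ (star a * a) = (r : ℂ)

/-- `φ` is faithful. -/
def Faithful [Ring A] [StarRing A] [Module ℂ A] (φ : A →ₗ[ℂ] ℂ) : Prop :=
  ∀ a : A, φ (star a * a) = 0 → a = 0

/-- `φ` is tracial. -/
def Tracial [Ring A] [Module ℂ A] (φ : A →ₗ[ℂ] ℂ) : Prop :=
  ∀ a b : A, φ (a * b) = φ (b * a)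

/-- All mixed cumulants with entries from `S` and from `T` vanish. -/
def MixedVanish (R : ∀ n, (Fin n → A) → ℂ) (S T : Set A) : Prop :=
  ∀ (n : ℕ) (f : Fin n → A), (∀ i, f i ∈ S ∪ T) → (∃ i, f i ∈ S) → (∃ j, f j ∈ T) →
    R n f = 0

/-- Two elements are free: all their mixed free cumulants vanish. -/
def FreeElems (R : ∀ n, (Fin n → A) → ℂ) (x y : A) : Prop :=
  MixedVanish R {x} {y}

/-- Interleaving of a partition `P` (placed at positions `1,2,…,n`, i.e. evens)
and `Q` (placed at positions `1̄,…,n̄`, i.e. odds) inside `Fin (2 * n)`. -/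
def interleave {n : ℕ} (P Q : Finset (Finset (Fin n))) : Finset (Finset (Fin (2 * n))) :=
  P.image (fun B => B.image fun i => (⟨2 * i.1, by have := i.isLt; omega⟩ : Fin (2 * n)))
    ∪ Q.image (fun B => B.image fun i => (⟨2 * i.1 + 1, by have := i.isLt; omega⟩ : Fin (2 * n)))

/-- `Q` refines ... : every block of `P` is contained in a block of `Q`. -/
def Refines {n : ℕ} (P Q : Finset (Finset (Fin n))) : Prop :=
  ∀ B ∈ P, ∃ C ∈ Q, B ⊆ C

/-- `Q` is the Kreweras complement of `P`: the largest partition whose interleaving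
with `P` is non-crossing. -/
def IsKrewerasComplement {n : ℕ} (P Q : Finset (Finset (Fin n))) : Prop :=
  IsPartition Q ∧ IsNonCrossing (interleave P Q) ∧
    ∀ Q', IsPartition Q' → IsNonCrossing (interleave P Q') → Refines Q' Q

end FreeProbLukacs

namespace FreeProbLukacs

/-- The cumulant of a list of entries. -/
def listCum (R : ∀ n, (Fin n → A) → ℂ) (L : List A) : ℂ := R L.length L.get

theorem listCum_ofFn (R : ∀ n, (Fin n → A) → ℂ) {n : ℕ} (f : Fin n → A) :
    listCum R (List.ofFn f) = R n f := by
  have key : ∀ (m : ℕ) (g : Fin m → A) (h : m = n), (∀ i : Fin m, g i = f (Fin.cast h i)) →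
      R m g = R n f := by
    rintro m g rfl h
    congr 1
    funext i
    exact h i
  refine key _ _ (List.length_ofFn) fun i => ?_
  simp only [List.get_ofFn]

theorem blockCum_eq_listCum (R : ∀ n, (Fin n → A) → ℂ) {n : ℕ} (X : Fin n → A)
    (B : Finset (Fin n)) :
    blockCum R X B = listCum R ((B.sort (· ≤ ·)).map X) := by
  rw [blockCum, ← listCum_ofFn R]
  congr 1
  refine List.ext_get (by simp) fun i h₁ h₂ => ?_
  simp

theorem blockCum_map (R : ∀ n, (Fin n → A) → ℂ) {k n : ℕ} (X : Fin n → A)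
    (e : Fin k ↪o Fin n) (B : Finset (Fin k)) :
    blockCum R X (B.map e.toEmbedding) = blockCum R (X ∘ e) B := by
  rw [blockCum_eq_listCum, blockCum_eq_listCum, ← List.map_map]
  congr 1
  have := map_sort (r := (· ≤ ·)) (r' := (· ≤ ·)) e.toEmbedding B (by simp)
  rw [← this]
  rfl

theorem blockCum_eq_zero {R : ∀ n, (Fin n → A) → ℂ} {S T : Set A} (h : MixedVanish R S T)
    {n : ℕ} {X : Fin n → A} (hX : ∀ i, X i ∈ S ∪ T) {B : Finset (Fin n)}
    {i j : Fin n} (hi : i ∈ B) (hj : j ∈ B) (hiS : X i ∈ S) (hjT : X j ∈ T) :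
    blockCum R X B = 0 := by
  have aux : ∀ i ∈ B, ∃ k : Fin B.card,
      (B.sort (· ≤ ·)).get (Fin.cast (Finset.length_sort (· ≤ ·)).symm k) = i := by
    intro i hi
    obtain ⟨k, hk⟩ := List.mem_iff_get.1 ((B.mem_sort (· ≤ ·)).2 hi)
    exact ⟨Fin.cast (Finset.length_sort (· ≤ ·)) k, hk⟩
  obtain ⟨a, ha⟩ := aux i hi
  obtain ⟨b, hb⟩ := aux j hj
  exact h _ _ (fun k => hX _) ⟨a, by rwa [ha]⟩ ⟨b, by rwa [hb]⟩

theorem partCum_eq_zero {R : ∀ n, (Fin n → A) → ℂ} {S T : Set A} (h : MixedVanish R S T)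
    {n : ℕ} {X : Fin n → A} (hX : ∀ i, X i ∈ S ∪ T) {P : Finset (Finset (Fin n))}
    {B : Finset (Fin n)} (hB : B ∈ P)
    {i j : Fin n} (hi : i ∈ B) (hj : j ∈ B) (hiS : X i ∈ S) (hjT : X j ∈ T) :
    partCum R X P = 0 :=
  prod_eq_zero hB (blockCum_eq_zero h hX hi hj hiS hjT)

theorem mem_NC {n : ℕ} {P : Finset (Finset (Fin n))} :
    P ∈ NC n ↔ IsPartition P ∧ IsNonCrossing P := by
  simp [NC]

theorem IsPartition.eq_of_mem {n : ℕ} {P : Finset (Finset (Fin n))} (hP : IsPartition P)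
    {B C : Finset (Fin n)} (hB : B ∈ P) (hC : C ∈ P) {i : Fin n} (hiB : i ∈ B) (hiC : i ∈ C) :
    B = C :=
  (hP.2 i).unique ⟨hB, hiB⟩ ⟨hC, hiC⟩

/-- The embedding of `Fin n` onto the first `n` points of `Fin (n + m)`. -/
def leftEmb (n m : ℕ) : Fin n ↪o Fin (n + m) := Fin.castAddOrderEmb m

/-- The embedding of `Fin m` onto the last `m` points of `Fin (n + m)`. -/
def rightEmb (n m : ℕ) : Fin m ↪o Fin (n + m) := Fin.natAddOrderEmb n

theorem append_leftEmb {n m : ℕ} (u : Fin n → A) (v : Fin m → A) (i : Fin n) :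
    Fin.append u v (leftEmb n m i) = u i :=
  Fin.append_left u v i

theorem append_rightEmb {n m : ℕ} (u : Fin n → A) (v : Fin m → A) (i : Fin m) :
    Fin.append u v (rightEmb n m i) = v i :=
  Fin.append_right u v i

theorem exists_leftEmb_or_rightEmb {n m : ℕ} (i : Fin (n + m)) :
    (∃ a, leftEmb n m a = i) ∨ ∃ b, rightEmb n m b = i := by
  induction i using Fin.addCases with
  | left i => exact Or.inl ⟨i, rfl⟩
  | right i => exact Or.inr ⟨i, rfl⟩

theorem leftEmb_lt_rightEmb {n m : ℕ} (i : Fin n) (j : Fin m) :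
    leftEmb n m i < rightEmb n m j := by
  have h : (i : ℕ) < n + j := by omega
  exact h

theorem mem_map_emb {k n : ℕ} (e : Fin k ↪o Fin n) {C : Finset (Fin k)} {i : Fin k} :
    e i ∈ C.map e.toEmbedding ↔ i ∈ C := by
  simp

theorem leftEmb_notMem_map {n m : ℕ} (C : Finset (Fin m)) (i : Fin n) :
    leftEmb n m i ∉ C.map (rightEmb n m).toEmbedding := by
  intro h
  obtain ⟨j, -, hj⟩ := Finset.mem_map.1 h
  exact (leftEmb_lt_rightEmb i j).ne' hj

theorem rightEmb_notMem_map {n m : ℕ} (C : Finset (Fin n)) (i : Fin m) :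
    rightEmb n m i ∉ C.map (leftEmb n m).toEmbedding := by
  intro h
  obtain ⟨j, -, hj⟩ := Finset.mem_map.1 h
  exact (leftEmb_lt_rightEmb j i).ne hj

/-- Juxtaposition of two partitions. -/
def juxtapose {n m : ℕ} (P : Finset (Finset (Fin n))) (Q : Finset (Finset (Fin m))) :
    Finset (Finset (Fin (n + m))) :=
  P.image (Finset.map (leftEmb n m).toEmbedding) ∪
    Q.image (Finset.map (rightEmb n m).toEmbedding)

theorem mem_juxtapose {n m : ℕ} {P : Finset (Finset (Fin n))} {Q : Finset (Finset (Fin m))}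
    {B : Finset (Fin (n + m))} :
    B ∈ juxtapose P Q ↔ (∃ C ∈ P, C.map (leftEmb n m).toEmbedding = B) ∨
      ∃ C ∈ Q, C.map (rightEmb n m).toEmbedding = B := by
  simp [juxtapose]

theorem juxtapose_mem_NC {n m : ℕ} {P : Finset (Finset (Fin n))} {Q : Finset (Finset (Fin m))}
    (hP : P ∈ NC n) (hQ : Q ∈ NC m) : juxtapose P Q ∈ NC (n + m) := by
  rw [mem_NC] at *
  obtain ⟨⟨hP0, hP1⟩, hP2⟩ := hP
  obtain ⟨⟨hQ0, hQ1⟩, hQ2⟩ := hQ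
  refine ⟨⟨?_, ?_⟩, ?_⟩
  · intro B hB
    rcases mem_juxtapose.1 hB with ⟨C, hC, rfl⟩ | ⟨C, hC, rfl⟩
    · exact (hP0 C hC).map
    · exact (hQ0 C hC).map
  · intro i
    rcases exists_leftEmb_or_rightEmb i with ⟨i, rfl⟩ | ⟨i, rfl⟩
    · obtain ⟨C, ⟨hC, hiC⟩, hu⟩ := hP1 i
      refine ⟨_, ⟨mem_juxtapose.2 (Or.inl ⟨C, hC, rfl⟩), (mem_map_emb _).2 hiC⟩, ?_⟩
      rintro B ⟨hB, hiB⟩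
      rcases mem_juxtapose.1 hB with ⟨C', hC', rfl⟩ | ⟨C', hC', rfl⟩
      · rw [hu C' ⟨hC', (mem_map_emb _).1 hiB⟩]
      · exact absurd hiB (leftEmb_notMem_map _ _)
    · obtain ⟨C, ⟨hC, hiC⟩, hu⟩ := hQ1 i
      refine ⟨_, ⟨mem_juxtapose.2 (Or.inr ⟨C, hC, rfl⟩), (mem_map_emb _).2 hiC⟩, ?_⟩
      rintro B ⟨hB, hiB⟩
      rcases mem_juxtapose.1 hB with ⟨C', hC', rfl⟩ | ⟨C', hC', rfl⟩
      · exact absurd hiB (rightEmb_notMem_map _ _)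
      · rw [hu C' ⟨hC', (mem_map_emb _).1 hiB⟩]
  · intro B₁ h₁ B₂ h₂ a ha b hb c hc d hd hab hbc hcd
    rcases mem_juxtapose.1 h₁ with ⟨C₁, hC₁, rfl⟩ | ⟨C₁, hC₁, rfl⟩ <;>
    rcases mem_juxtapose.1 h₂ with ⟨C₂, hC₂, rfl⟩ | ⟨C₂, hC₂, rfl⟩ <;>
    obtain ⟨a, ha', rfl⟩ := Finset.mem_map.1 ha <;>
    obtain ⟨b, hb', rfl⟩ := Finset.mem_map.1 hb <;>
    obtain ⟨c, hc', rfl⟩ := Finset.mem_map.1 hc <;>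
    obtain ⟨d, hd', rfl⟩ := Finset.mem_map.1 hd
    · rw [hP2 C₁ hC₁ C₂ hC₂ a ha' b hb' c hc' d hd' (by simpa using hab) (by simpa using hbc)
        (by simpa using hcd)]
    · exact absurd hbc (leftEmb_lt_rightEmb c b).asymm
    · exact absurd hab (leftEmb_lt_rightEmb b a).asymm
    · rw [hQ2 C₁ hC₁ C₂ hC₂ a ha' b hb' c hc' d hd' (by simpa using hab) (by simpa using hbc)
        (by simpa using hcd)]

/-- The part of `P` pulled back along an embedding of index sets. -/
def pullback {k n : ℕ} (e : Fin k ↪o Fin n) (P : Finset (Finset (Fin n))) :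
    Finset (Finset (Fin k)) :=
  univ.filter fun C => C.map e.toEmbedding ∈ P

theorem mem_pullback {k n : ℕ} {e : Fin k ↪o Fin n} {P : Finset (Finset (Fin n))}
    {C : Finset (Fin k)} : C ∈ pullback e P ↔ C.map e.toEmbedding ∈ P := by
  simp [pullback]

theorem pullback_mem_NC {k n : ℕ} (e : Fin k ↪o Fin n) {P : Finset (Finset (Fin n))}
    (hP : P ∈ NC n)
    (h : ∀ i, ∀ B ∈ P, e i ∈ B → ∃ C : Finset (Fin k), C.map e.toEmbedding = B) :
    pullback e P ∈ NC k := by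
  rw [mem_NC] at *
  refine ⟨⟨?_, fun i => ?_⟩, ?_⟩
  · intro C hC
    exact Finset.map_nonempty.1 (hP.1.1 _ (mem_pullback.1 hC))
  · obtain ⟨B, ⟨hB, hiB⟩, -⟩ := hP.1.2 (e i)
    obtain ⟨C, rfl⟩ := h i B hB hiB
    refine ⟨C, ⟨mem_pullback.2 hB, (mem_map_emb e).1 hiB⟩, ?_⟩
    rintro C' ⟨hC', hi⟩
    exact Finset.map_injective e.toEmbedding
      (hP.1.eq_of_mem (mem_pullback.1 hC') hB ((mem_map_emb e).2 hi) hiB)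
  · intro B₁ h₁ B₂ h₂ a ha b hb c hc d hd hab hbc hcd
    exact Finset.map_injective e.toEmbedding
      (hP.2 _ (mem_pullback.1 h₁) _ (mem_pullback.1 h₂)
        (e a) ((mem_map_emb e).2 ha) (e b) ((mem_map_emb e).2 hb) (e c) ((mem_map_emb e).2 hc)
        (e d) ((mem_map_emb e).2 hd) (by simpa using hab) (by simpa using hbc)
        (by simpa using hcd))

theorem pullback_leftEmb_juxtapose {n m : ℕ} (P : Finset (Finset (Fin n)))
    {Q : Finset (Finset (Fin m))} (hQ : Q ∈ NC m) :
    pullback (leftEmb n m) (juxtapose P Q) = P := by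
  ext C
  rw [mem_pullback, mem_juxtapose]
  constructor
  · rintro (⟨C', hC', h⟩ | ⟨C', hC', h⟩)
    · rwa [← Finset.map_injective _ h]
    · obtain ⟨j, hj⟩ := (mem_NC.1 hQ).1.1 C' hC'
      exact absurd (h ▸ (mem_map_emb _).2 hj) (rightEmb_notMem_map C j)
  · intro h
    exact Or.inl ⟨C, h, rfl⟩

theorem pullback_rightEmb_juxtapose {n m : ℕ} {P : Finset (Finset (Fin n))}
    (Q : Finset (Finset (Fin m))) (hP : P ∈ NC n) :
    pullback (rightEmb n m) (juxtapose P Q) = Q := by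
  ext C
  rw [mem_pullback, mem_juxtapose]
  constructor
  · rintro (⟨C', hC', h⟩ | ⟨C', hC', h⟩)
    · obtain ⟨j, hj⟩ := (mem_NC.1 hP).1.1 C' hC'
      exact absurd (h ▸ (mem_map_emb _).2 hj) (leftEmb_notMem_map C j)
    · rwa [← Finset.map_injective _ h]
  · intro h
    exact Or.inr ⟨C, h, rfl⟩

theorem partCum_juxtapose (R : ∀ n, (Fin n → A) → ℂ) {n m : ℕ} (u : Fin n → A) (v : Fin m → A)
    {P : Finset (Finset (Fin n))} {Q : Finset (Finset (Fin m))} (hP : P ∈ NC n) :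
    partCum R (Fin.append u v) (juxtapose P Q) = partCum R u P * partCum R v Q := by
  rw [partCum, juxtapose, prod_union, prod_image, prod_image]
  · congr 1
    · refine prod_congr rfl fun B _ => ?_
      rw [blockCum_map]
      congr 1
      funext i
      exact append_leftEmb u v i
    · refine prod_congr rfl fun B _ => ?_
      rw [blockCum_map]
      congr 1
      funext i
      exact append_rightEmb u v i
  · exact (Finset.map_injective _).injOn
  · exact (Finset.map_injective _).injOn
  · rw [Finset.disjoint_left]
    intro B hB hB'
    obtain ⟨C, hC, rfl⟩ := Finset.mem_image.1 hB
    obtain ⟨C', hC', h⟩ := Finset.mem_image.1 hB'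
    obtain ⟨j, hj⟩ := (mem_NC.1 hP).1.1 C hC
    exact absurd (h ▸ (mem_map_emb _).2 hj) (leftEmb_notMem_map C' j)

theorem exists_map_leftEmb {n m : ℕ} {B : Finset (Fin (n + m))}
    (h : ∀ j : Fin m, rightEmb n m j ∉ B) :
    ∃ C : Finset (Fin n), C.map (leftEmb n m).toEmbedding = B := by
  refine ⟨univ.filter fun i => leftEmb n m i ∈ B, ?_⟩
  ext i
  rcases exists_leftEmb_or_rightEmb i with ⟨i, rfl⟩ | ⟨i, rfl⟩
  · rw [mem_map_emb]
    simp
  · simp only [h i, iff_false]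
    exact rightEmb_notMem_map _ _

theorem exists_map_rightEmb {n m : ℕ} {B : Finset (Fin (n + m))}
    (h : ∀ j : Fin n, leftEmb n m j ∉ B) :
    ∃ C : Finset (Fin m), C.map (rightEmb n m).toEmbedding = B := by
  refine ⟨univ.filter fun i => rightEmb n m i ∈ B, ?_⟩
  ext i
  rcases exists_leftEmb_or_rightEmb i with ⟨i, rfl⟩ | ⟨i, rfl⟩
  · simp only [h i, iff_false]
    exact leftEmb_notMem_map _ _
  · rw [mem_map_emb]
    simp

theorem sum_partCum_append {R : ∀ n, (Fin n → A) → ℂ} {S T : Set A} (h : MixedVanish R S T)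
    {n m : ℕ} {u : Fin n → A} {v : Fin m → A} (hu : ∀ i, u i ∈ S) (hv : ∀ i, v i ∈ T) :
    ∑ P ∈ NC (n + m), partCum R (Fin.append u v) P =
      (∑ P ∈ NC n, partCum R u P) * ∑ P ∈ NC m, partCum R v P := by
  rw [sum_mul_sum, ← sum_product']
  symm
  have hX : ∀ i, Fin.append u v i ∈ S ∪ T := by
    intro i
    rcases exists_leftEmb_or_rightEmb i with ⟨i, rfl⟩ | ⟨i, rfl⟩
    · rw [append_leftEmb]
      exact Or.inl (hu i)
    · rw [append_rightEmb]
      exact Or.inr (hv i)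
  refine sum_of_injOn (fun p => juxtapose p.1 p.2) ?_ ?_ ?_ ?_
  · rintro ⟨P, Q⟩ hPQ ⟨P', Q'⟩ hPQ' heq
    simp only [coe_product, Set.mem_prod, mem_coe] at hPQ hPQ' heq
    have hl := congrArg (pullback (leftEmb n m)) heq
    have hr := congrArg (pullback (rightEmb n m)) heq
    rw [pullback_leftEmb_juxtapose _ hPQ.2, pullback_leftEmb_juxtapose _ hPQ'.2] at hl
    rw [pullback_rightEmb_juxtapose _ hPQ.1, pullback_rightEmb_juxtapose _ hPQ'.1] at hr
    rw [hl, hr]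
  · rintro ⟨P, Q⟩ hPQ
    simp only [coe_product, Set.mem_prod, mem_coe] at hPQ ⊢
    exact juxtapose_mem_NC hPQ.1 hPQ.2
  · intro P hP hP'
    by_contra hne
    have hmix : ∀ B ∈ P, ∀ i j, leftEmb n m i ∈ B → rightEmb n m j ∉ B := by
      intro B hB i j hi hj
      refine hne (partCum_eq_zero h hX hB hi hj ?_ ?_)
      · rw [append_leftEmb]
        exact hu i
      · rw [append_rightEmb]
        exact hv j
    refine hP' ⟨(pullback (leftEmb n m) P, pullback (rightEmb n m) P), ?_, ?_⟩
    · simp only [coe_product, Set.mem_prod, mem_coe]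
      exact ⟨pullback_mem_NC _ hP fun i B hB hi => exists_map_leftEmb fun j => hmix B hB i j hi,
        pullback_mem_NC _ hP fun i B hB hi => exists_map_rightEmb fun j hj => hmix B hB j i hj hi⟩
    · ext B
      simp only [mem_juxtapose, mem_pullback]
      constructor
      · rintro (⟨C, hC, rfl⟩ | ⟨C, hC, rfl⟩) <;> exact hC
      · intro hB
        by_cases hi : ∃ i, leftEmb n m i ∈ B
        · obtain ⟨i, hi⟩ := hi
          obtain ⟨C, rfl⟩ := exists_map_leftEmb fun j => hmix B hB i j hi
          exact Or.inl ⟨C, hB, rfl⟩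
        · push Not at hi
          obtain ⟨C, rfl⟩ := exists_map_rightEmb hi
          exact Or.inr ⟨C, hB, rfl⟩
  · rintro ⟨P, Q⟩ hPQ
    simp only [mem_product] at hPQ
    exact (partCum_juxtapose R u v hPQ.1).symm

theorem tprod_append [Monoid A] {n m : ℕ} (u : Fin n → A) (v : Fin m → A) :
    tprod (Fin.append u v) = tprod u * tprod v := by
  simp [tprod, List.ofFn_fin_append]

theorem MomentCumulant.map_tprod_mul_tprod [Monoid A] {φ : A → ℂ} {R : ∀ n, (Fin n → A) → ℂ}
    (hmc : MomentCumulant φ R) {S T : Set A} (h : MixedVanish R S T)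
    {n m : ℕ} {u : Fin n → A} {v : Fin m → A} (hu : ∀ i, u i ∈ S) (hv : ∀ i, v i ∈ T) :
    φ (tprod u * tprod v) = φ (tprod u) * φ (tprod v) := by
  rw [← tprod_append, hmc, hmc, hmc, sum_partCum_append h hu hv]

theorem MomentCumulant.map_pow_mul_pow [Monoid A] {φ : A → ℂ} {R : ∀ n, (Fin n → A) → ℂ}
    (hmc : MomentCumulant φ R) {S T : Set A} (h : MixedVanish R S T) {a b : A}
    (ha : a ∈ S) (hb : b ∈ T) (n m : ℕ) :
    φ (a ^ n * b ^ m) = φ (a ^ n) * φ (b ^ m) := by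
  simpa [tprod] using hmc.map_tprod_mul_tprod h (u := fun _ : Fin n => a)
    (v := fun _ : Fin m => b) (fun _ => ha) fun _ => hb

/-- Boolean test for being a partition. -/
def partTest {n : ℕ} (P : Finset (Finset (Fin n))) : Bool :=
  decide (∀ B ∈ P, B.Nonempty) &&
    decide (∀ i : Fin n, ∃ B ∈ P, i ∈ B ∧ ∀ C ∈ P, i ∈ C → C = B)

/-- Boolean test for the existence of a crossing of `B` and `C`. -/
def crossTest {n : ℕ} (B C : Finset (Fin n)) : Bool :=
  decide (∃ a ∈ B, ∃ c ∈ B, ∃ b ∈ C, ∃ d ∈ C, a < b ∧ b < c ∧ c < d)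

/-- Boolean test for being a non-crossing partition. -/
def testNC {n : ℕ} (P : Finset (Finset (Fin n))) : Bool :=
  partTest P && decide (∀ B ∈ P, ∀ C ∈ P, B = C ∨ crossTest B C = false)

theorem mem_NC_iff_testNC {n : ℕ} {P : Finset (Finset (Fin n))} :
    P ∈ NC n ↔ testNC P = true := by
  rw [mem_NC, testNC, Bool.and_eq_true, partTest, Bool.and_eq_true, decide_eq_true_iff,
    decide_eq_true_iff, decide_eq_true_iff]
  refine and_congr (and_congr Iff.rfl (forall_congr' fun i => exists_congr fun B => ?_)) ?_
  · simp only [and_imp, and_assoc]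
  · refine forall₂_congr fun B _ => forall₂_congr fun C _ => ?_
    rw [crossTest, decide_eq_false_iff_not]
    constructor
    · intro h
      by_contra! hne
      obtain ⟨hne, a, ha, c, hc, b, hb, d, hd, hab, hbc, hcd⟩ := hne
      exact hne (h a ha b hb c hc d hd hab hbc hcd)
    · intro h a ha b hb c hc d hd hab hbc hcd
      rcases h with h | h
      · exact h
      · exact absurd ⟨a, ha, c, hc, b, hb, d, hd, hab, hbc, hcd⟩ h

theorem NC_one : NC 1 = {{{0}}} := by
  ext P
  rw [mem_NC_iff_testNC]
  revert P
  decide +kernel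

theorem NC_two : NC 2 = {{{0, 1}}, {{0}, {1}}} := by
  ext P
  rw [mem_NC_iff_testNC]
  revert P
  decide +kernel

theorem NC_three : NC 3 =
    {{{0, 1, 2}}, {{0}, {1, 2}}, {{0, 1}, {2}}, {{0, 2}, {1}}, {{0}, {1}, {2}}} := by
  ext P
  rw [mem_NC_iff_testNC]
  revert P
  decide +kernel

theorem IsPartition.eq_of_subset {n : ℕ} {P Q : Finset (Finset (Fin n))} (hP : IsPartition P)
    (hQ : Q ⊆ P) (h : ∀ i, ∃ B ∈ Q, i ∈ B) : P = Q := by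
  refine Subset.antisymm (fun B hB => ?_) hQ
  obtain ⟨i, hi⟩ := hP.1 B hB
  obtain ⟨C, hC, hiC⟩ := h i
  rwa [hP.eq_of_mem hB (hQ hC) hi hiC]

theorem IsPartition.false_of_inter {n : ℕ} {P : Finset (Finset (Fin n))} (hP : IsPartition P)
    {B C : Finset (Fin n)} (hB : B ∈ P) (hC : C ∈ P) (h : (B ∩ C).Nonempty) (hne : B ≠ C) :
    False := by
  obtain ⟨i, hi⟩ := h
  rw [mem_inter] at hi
  exact hne (hP.eq_of_mem hB hC hi.1 hi.2)

/-- The non-crossing partitions of five points refining `{{0, 2, 3}, {1, 4}}`. -/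
def splitFive : Finset (Finset (Finset (Fin 5))) :=
  {{{0, 2, 3}, {1}, {4}}, {{0}, {2, 3}, {1}, {4}}, {{0, 2}, {3}, {1}, {4}},
    {{0, 3}, {2}, {1}, {4}}, {{0}, {2}, {3}, {1}, {4}}, {{0}, {2, 3}, {1, 4}},
    {{0}, {2}, {3}, {1, 4}}}

theorem splitFive_subset : splitFive ⊆ NC 5 := by
  simp only [splitFive, insert_subset_iff, singleton_subset_iff, mem_NC_iff_testNC]
  refine ⟨?_, ?_, ?_, ?_, ?_, ?_, ?_⟩
  all_goals decide +kernel

theorem mem_splitFive {P : Finset (Finset (Fin 5))} (hP : P ∈ NC 5)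
    (h : ∀ B ∈ P, B ⊆ {0, 2, 3} ∨ B ⊆ {1, 4}) : P ∈ splitFive := by
  obtain ⟨hpart, hcross⟩ := mem_NC.1 hP
  have block : ∀ i : Fin 5, ∃ B ∈ P, i ∈ B ∧ (B ⊆ {0, 2, 3} ∨ B ⊆ {1, 4}) := fun i => by
    obtain ⟨B, ⟨hB, hi⟩, -⟩ := hpart.2 i
    exact ⟨B, hB, hi, h B hB⟩
  have l0 : ∀ B : Finset (Fin 5), 0 ∈ B → (B ⊆ {0, 2, 3} ∨ B ⊆ {1, 4}) →
      B = {0} ∨ B = {0, 2} ∨ B = {0, 3} ∨ B = {0, 2, 3} := by decide +kernel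
  have l1 : ∀ B : Finset (Fin 5), 1 ∈ B → (B ⊆ {0, 2, 3} ∨ B ⊆ {1, 4}) →
      B = {1} ∨ B = {1, 4} := by decide +kernel
  have l2 : ∀ B : Finset (Fin 5), 2 ∈ B → (B ⊆ {0, 2, 3} ∨ B ⊆ {1, 4}) →
      B = {2} ∨ B = {0, 2} ∨ B = {2, 3} ∨ B = {0, 2, 3} := by decide +kernel
  have l3 : ∀ B : Finset (Fin 5), 3 ∈ B → (B ⊆ {0, 2, 3} ∨ B ⊆ {1, 4}) →
      B = {3} ∨ B = {0, 3} ∨ B = {2, 3} ∨ B = {0, 2, 3} := by decide +kernel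
  have l4 : ∀ B : Finset (Fin 5), 4 ∈ B → (B ⊆ {0, 2, 3} ∨ B ⊆ {1, 4}) →
      B = {4} ∨ B = {1, 4} := by decide +kernel
  obtain ⟨B0, h0, m0, s0⟩ := block 0
  obtain ⟨B1, h1, m1, s1⟩ := block 1
  obtain ⟨B2, h2, m2, s2⟩ := block 2
  obtain ⟨B3, h3, m3, s3⟩ := block 3
  obtain ⟨B4, h4, m4, s4⟩ := block 4
  have hQ : P = {B0, B1, B2, B3, B4} := by
    refine hpart.eq_of_subset (by simp [insert_subset_iff, *]) fun i => ?_
    fin_cases i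
    exacts [⟨B0, by simp, m0⟩, ⟨B1, by simp, m1⟩, ⟨B2, by simp, m2⟩, ⟨B3, by simp, m3⟩,
      ⟨B4, by simp, m4⟩]
  have c2 : 2 ∈ B0 → 4 ∉ B1 := fun a b =>
    hpart.false_of_inter h0 h1 (by
      rw [hcross _ h0 _ h1 0 m0 1 m1 2 a 4 b (by decide) (by decide) (by decide), inter_self]
      exact ⟨1, m1⟩) (by
      rintro rfl
      rcases s0 with s0 | s0
      · exact absurd (s0 m1) (by decide)
      · exact absurd (s0 m0) (by decide))
  have c3 : 3 ∈ B0 → 4 ∉ B1 := fun a b =>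
    hpart.false_of_inter h0 h1 (by
      rw [hcross _ h0 _ h1 0 m0 1 m1 3 a 4 b (by decide) (by decide) (by decide), inter_self]
      exact ⟨1, m1⟩) (by
      rintro rfl
      rcases s0 with s0 | s0
      · exact absurd (s0 m1) (by decide)
      · exact absurd (s0 m0) (by decide))
  replace l0 := l0 B0 m0 s0
  replace l1 := l1 B1 m1 s1
  replace l2 := l2 B2 m2 s2
  replace l3 := l3 B3 m3 s3
  replace l4 := l4 B4 m4 s4
  clear block m0 m1 m2 m3 m4 s0 s1 s2 s3 s4
  rcases l0 with rfl | rfl | rfl | rfl <;> rcases l2 with rfl | rfl | rfl | rfl <;>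
    try exact (hpart.false_of_inter h0 h2 (by decide +kernel) (by decide +kernel)).elim
  all_goals rcases l3 with rfl | rfl | rfl | rfl <;>
    first
    | exact (hpart.false_of_inter h0 h3 (by decide +kernel) (by decide +kernel)).elim
    | exact (hpart.false_of_inter h2 h3 (by decide +kernel) (by decide +kernel)).elim
    | skip
  all_goals rcases l1 with rfl | rfl <;> rcases l4 with rfl | rfl <;>
    first
    | exact (hpart.false_of_inter h1 h4 (by decide +kernel) (by decide +kernel)).elim
    | exact (c2 (by decide +kernel) (by decide +kernel)).elim
    | exact (c3 (by decide +kernel) (by decide +kernel)).elim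
    | skip
  all_goals
    rw [hQ, splitFive]
    simp only [mem_insert, mem_singleton]
    decide +kernel

theorem blockCum_toFinset (R : ∀ n, (Fin n → A) → ℂ) {n : ℕ} (X : Fin n → A)
    {B : Finset (Fin n)} (L : List (Fin n)) (hB : B = L.toFinset) (hL : L.Pairwise (· < ·)) :
    blockCum R X B = listCum R (L.map X) := by
  subst hB
  rw [blockCum_eq_listCum, (List.toFinset_sort (· ≤ ·) hL.nodup).2 (hL.imp le_of_lt)]

section Moments

variable [Monoid A] {φ : A → ℂ} {R : ∀ n, (Fin n → A) → ℂ}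

theorem MomentCumulant.map_one (hmc : MomentCumulant φ R) (a : A) : φ a = listCum R [a] := by
  have h := hmc 1 ![a]
  rw [NC_one, sum_singleton, partCum, prod_singleton,
    blockCum_toFinset R _ [0] (by decide) (by decide)] at h
  simpa [tprod] using h

theorem MomentCumulant.map_two (hmc : MomentCumulant φ R) (a b : A) :
    φ (a * b) = listCum R [a, b] + listCum R [a] * listCum R [b] := by
  have h := hmc 2 ![a, b]
  rw [NC_two, sum_insert (by decide +kernel), sum_singleton, partCum, prod_singleton, partCum,
    prod_insert (by decide +kernel), prod_singleton,
    blockCum_toFinset R _ [0, 1] (by decide +kernel) (by decide),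
    blockCum_toFinset R _ [0] (by decide +kernel) (by decide),
    blockCum_toFinset R _ [1] (by decide +kernel) (by decide)] at h
  simpa [tprod] using h

theorem MomentCumulant.map_three (hmc : MomentCumulant φ R) (a b c : A) :
    φ (a * (b * c)) = listCum R [a, b, c] + listCum R [a] * listCum R [b, c] +
      listCum R [a, b] * listCum R [c] + listCum R [a, c] * listCum R [b] +
      listCum R [a] * listCum R [b] * listCum R [c] := by
  have h := hmc 3 ![a, b, c]
  rw [NC_three, sum_insert (by decide +kernel), sum_insert (by decide +kernel),
    sum_insert (by decide +kernel), sum_insert (by decide +kernel), sum_singleton] at h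
  simp only [partCum] at h
  rw [prod_singleton, prod_insert (by decide +kernel), prod_singleton,
    prod_insert (by decide +kernel), prod_singleton, prod_insert (by decide +kernel),
    prod_singleton, prod_insert (by decide +kernel), prod_insert (by decide +kernel),
    prod_singleton,
    blockCum_toFinset R _ [0, 1, 2] (by decide +kernel) (by decide),
    blockCum_toFinset R _ [0] (by decide +kernel) (by decide),
    blockCum_toFinset R _ [1, 2] (by decide +kernel) (by decide),
    blockCum_toFinset R _ [0, 1] (by decide +kernel) (by decide),
    blockCum_toFinset R _ [2] (by decide +kernel) (by decide),
    blockCum_toFinset R _ [0, 2] (by decide +kernel) (by decide),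
    blockCum_toFinset R _ [1] (by decide +kernel) (by decide)] at h
  simp [tprod] at h
  rw [h]
  ring

theorem MomentCumulant.map_five (hmc : MomentCumulant φ R) {S T : Set A}
    (hST : MixedVanish R S T) {a b c d e : A} (ha : a ∈ S) (hb : b ∈ T) (hc : c ∈ S) (hd : d ∈ S)
    (he : e ∈ T) :
    φ (a * (b * (c * (d * e)))) =
      φ b * φ e * φ (a * (c * d)) + (φ (b * e) - φ b * φ e) * (φ a * φ (c * d)) := by
  have h := hmc 5 ![a, b, c, d, e]
  have hX : ∀ i, ![a, b, c, d, e] i ∈ S ∪ T := by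
    intro i
    fin_cases i
    exacts [Or.inl ha, Or.inr hb, Or.inl hc, Or.inl hd, Or.inr he]
  rw [← sum_subset splitFive_subset fun P hP hP' => ?_] at h
  rotate_left
  · by_contra hne
    refine hP' (mem_splitFive hP fun B hB => ?_)
    have hmono : ∀ i ∈ B, ∀ j ∈ B, ![a, b, c, d, e] i ∈ S → ![a, b, c, d, e] j ∉ T :=
      fun i hi j hj hiS hjT => hne (partCum_eq_zero hST hX hB hi hj hiS hjT)
    have key : ∀ B : Finset (Fin 5), (∀ i ∈ B, ∀ j ∈ B, i ∈ ({0, 2, 3} : Finset (Fin 5)) →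
        j ∉ ({1, 4} : Finset (Fin 5))) → B ⊆ {0, 2, 3} ∨ B ⊆ {1, 4} := by decide +kernel
    refine key B fun i hi j hj hiS hjT => hmono i hi j hj ?_ ?_
    · fin_cases i
      exacts [ha, absurd hiS (by decide), hc, hd, absurd hiS (by decide)]
    · fin_cases j
      exacts [absurd hjT (by decide), hb, absurd hjT (by decide), absurd hjT (by decide), he]
  rw [splitFive, sum_insert (by decide +kernel), sum_insert (by decide +kernel),
    sum_insert (by decide +kernel), sum_insert (by decide +kernel), sum_insert (by decide +kernel),
    sum_insert (by decide +kernel), sum_singleton] at h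
  simp only [partCum] at h
  rw [prod_insert (by decide +kernel), prod_insert (by decide +kernel), prod_singleton,
    prod_insert (by decide +kernel), prod_insert (by decide +kernel),
    prod_insert (by decide +kernel), prod_singleton, prod_insert (by decide +kernel),
    prod_insert (by decide +kernel), prod_insert (by decide +kernel), prod_singleton,
    prod_insert (by decide +kernel), prod_insert (by decide +kernel),
    prod_insert (by decide +kernel), prod_singleton, prod_insert (by decide +kernel),
    prod_insert (by decide +kernel), prod_insert (by decide +kernel),
    prod_insert (by decide +kernel), prod_singleton, prod_insert (by decide +kernel),
    prod_insert (by decide +kernel), prod_singleton, prod_insert (by decide +kernel),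
    prod_insert (by decide +kernel), prod_insert (by decide +kernel), prod_singleton,
    blockCum_toFinset R _ (B := {0, 2, 3}) [0, 2, 3] (by decide +kernel) (by decide),
    blockCum_toFinset R _ (B := {0}) [0] (by decide +kernel) (by decide),
    blockCum_toFinset R _ (B := {1}) [1] (by decide +kernel) (by decide),
    blockCum_toFinset R _ (B := {2}) [2] (by decide +kernel) (by decide),
    blockCum_toFinset R _ (B := {3}) [3] (by decide +kernel) (by decide),
    blockCum_toFinset R _ (B := {4}) [4] (by decide +kernel) (by decide),
    blockCum_toFinset R _ (B := {0, 2}) [0, 2] (by decide +kernel) (by decide),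
    blockCum_toFinset R _ (B := {0, 3}) [0, 3] (by decide +kernel) (by decide),
    blockCum_toFinset R _ (B := {2, 3}) [2, 3] (by decide +kernel) (by decide),
    blockCum_toFinset R _ (B := {1, 4}) [1, 4] (by decide +kernel) (by decide)] at h
  simp [tprod] at h
  rw [h, hmc.map_three, hmc.map_two, hmc.map_two, hmc.map_one a, hmc.map_one b, hmc.map_one e]
  ring

theorem MomentCumulant.cumulant_two (hmc : MomentCumulant φ R) (a b : A) :
    R 2 ![a, b] = φ (a * b) - φ a * φ b := by
  rw [hmc.map_two, hmc.map_one a, hmc.map_one b, ← listCum_ofFn R]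
  simp

end Moments

section MarchenkoPastur

open MeasureTheory

/-- Left endpoint of the Marchenko–Pastur law with rate `l` and jump size `1`. -/
def mpLeft (l : ℝ) : ℝ := (1 + l) - 2 * Real.sqrt l

/-- Right endpoint of the Marchenko–Pastur law with rate `l` and jump size `1`. -/
def mpRight (l : ℝ) : ℝ := (1 + l) + 2 * Real.sqrt l

/-- The integral of `x ^ k` against the unnormalised semicircle over the Marchenko–Pastur
support. -/
def mpInt (l : ℝ) (k : ℤ) : ℝ :=
  ∫ x in mpLeft l..mpRight l, Real.sqrt (4 * l - (x - (1 + l)) ^ 2) * x ^ k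

variable {l : ℝ}

theorem mpLeft_pos (hl : 1 < l) : 0 < mpLeft l := by
  have h := Real.sq_sqrt (by linarith : 0 ≤ l)
  have h1 : 1 < Real.sqrt l := Real.lt_sqrt_of_sq_lt (by linarith)
  rw [mpLeft]
  nlinarith

theorem mpLeft_lt_mpRight (hl : 1 < l) : mpLeft l < mpRight l := by
  have h1 : 0 < Real.sqrt l := Real.sqrt_pos.2 (by linarith)
  rw [mpLeft, mpRight]
  linarith

theorem mp_quadratic (hl : 1 < l) (x : ℝ) :
    4 * l - (x - (1 + l)) ^ 2 = (x - mpLeft l) * (mpRight l - x) := by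
  have h := Real.sq_sqrt (by linarith : 0 ≤ l)
  rw [mpLeft, mpRight]
  linear_combination (-4) * h

theorem mp_quadratic_nonneg (hl : 1 < l) {x : ℝ} (hx : x ∈ Set.Icc (mpLeft l) (mpRight l)) :
    0 ≤ 4 * l - (x - (1 + l)) ^ 2 := by
  rw [mp_quadratic hl]
  exact mul_nonneg (by linarith [hx.1]) (by linarith [hx.2])

theorem mp_quadratic_nonpos (hl : 1 < l) {x : ℝ} (hx : x ∉ Set.Icc (mpLeft l) (mpRight l)) :
    4 * l - (x - (1 + l)) ^ 2 ≤ 0 := by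
  have h := mpLeft_lt_mpRight hl
  rw [mp_quadratic hl]
  by_cases h1 : mpLeft l ≤ x
  · exact mul_nonpos_of_nonneg_of_nonpos (by linarith)
      (by by_contra! h2; exact hx ⟨h1, by linarith⟩)
  · exact mul_nonpos_of_nonpos_of_nonneg (by linarith) (by linarith)

theorem integral_freePoissonMeasure (hl : 1 < l) (f : ℝ → ℝ) :
    ∫ t, f t ∂freePoissonMeasure l 1 =
      ∫ x in mpLeft l..mpRight l,
        f x * (Real.sqrt (4 * l - (x - (1 + l)) ^ 2) / (2 * Real.pi * x)) := by
  have hd : freePoissonDensity l 1 = fun x =>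
      Real.sqrt (4 * l - (x - (1 + l)) ^ 2) / (2 * Real.pi * x) := by
    funext x
    simp [freePoissonDensity]
  have hmeas : Measurable (freePoissonDensity l 1) := by
    rw [hd]
    fun_prop
  rw [freePoissonMeasure, max_eq_left (by linarith), ENNReal.ofReal_zero, zero_smul, zero_add,
    integral_withDensity_eq_integral_toReal_smul hmeas.ennreal_ofReal
      (by simp),
    intervalIntegral.integral_of_le (mpLeft_lt_mpRight hl).le, ← integral_Icc_eq_integral_Ioc,
    ← setIntegral_eq_integral_of_forall_compl_eq_zero (s := Set.Icc (mpLeft l) (mpRight l))]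
  · refine setIntegral_congr_fun measurableSet_Icc fun x hx => ?_
    have hx0 : 0 < x := (mpLeft_pos hl).trans_le hx.1
    simp only [hd]
    rw [ENNReal.toReal_ofReal (by positivity), smul_eq_mul, mul_comm]
  · intro x hx
    simp only [hd]
    rw [Real.sqrt_eq_zero_of_nonpos (mp_quadratic_nonpos hl hx)]
    simp

theorem integral_freePoissonMeasure_zpow (hl : 1 < l) (k : ℤ) :
    ∫ t, t ^ k ∂freePoissonMeasure l 1 = mpInt l (k - 1) / (2 * Real.pi) := by
  rw [integral_freePoissonMeasure hl, mpInt, ← intervalIntegral.integral_div]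
  refine intervalIntegral.integral_congr fun x hx => ?_
  rw [Set.uIcc_of_le (mpLeft_lt_mpRight hl).le] at hx
  have hx0 : x ≠ 0 := ((mpLeft_pos hl).trans_le hx.1).ne'
  simp only [zpow_sub_one₀ hx0]
  field_simp

theorem continuousOn_zpow_mp (hl : 1 < l) (k : ℤ) :
    ContinuousOn (fun x : ℝ => x ^ k) (Set.uIcc (mpLeft l) (mpRight l)) := by
  rw [Set.uIcc_of_le (mpLeft_lt_mpRight hl).le]
  exact fun x hx => (continuousAt_zpow₀ x k
    (Or.inl ((mpLeft_pos hl).trans_le hx.1).ne')).continuousWithinAt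

theorem intervalIntegrable_mp (hl : 1 < l) (k : ℤ) :
    IntervalIntegrable (fun x => Real.sqrt (4 * l - (x - (1 + l)) ^ 2) * x ^ k) volume
      (mpLeft l) (mpRight l) :=
  (ContinuousOn.mul (by fun_prop) (continuousOn_zpow_mp hl k)).intervalIntegrable

theorem mpInt_recurrence (hl : 1 < l) (k : ℤ) :
    -(3 + k) * mpInt l (k + 1) + (3 + 2 * k) * (1 + l) * mpInt l k
      - k * (l - 1) ^ 2 * mpInt l (k - 1) = 0 := by
  have hlt := mpLeft_lt_mpRight hl
  have hinteg : ∀ (c : ℝ) (k : ℤ), IntervalIntegrable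
      (fun x => c * (Real.sqrt (4 * l - (x - (1 + l)) ^ 2) * x ^ k)) volume
        (mpLeft l) (mpRight l) :=
    fun c k => (intervalIntegrable_mp hl k).const_mul c
  have hder : ∀ x ∈ Set.uIcc (mpLeft l) (mpRight l),
      HasDerivAt (fun x : ℝ => (4 * l - (x - (1 + l)) ^ 2) ^ (3 / 2 : ℝ) * x ^ k)
        (-(3 + k) * (Real.sqrt (4 * l - (x - (1 + l)) ^ 2) * x ^ (k + 1)) +
          (3 + 2 * k) * (1 + l) * (Real.sqrt (4 * l - (x - (1 + l)) ^ 2) * x ^ k) -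
          k * (l - 1) ^ 2 * (Real.sqrt (4 * l - (x - (1 + l)) ^ 2) * x ^ (k - 1))) x := by
    intro x hx
    rw [Set.uIcc_of_le hlt.le] at hx
    have hx0 : x ≠ 0 := ((mpLeft_pos hl).trans_le hx.1).ne'
    have hq := mp_quadratic_nonneg hl hx
    have h1 : HasDerivAt (fun x : ℝ => 4 * l - (x - (1 + l)) ^ 2) (-(2 * (x - (1 + l)))) x := by
      simpa using (((hasDerivAt_id x).sub_const (1 + l)).pow 2).const_sub (4 * l)
    have h2 := (h1.rpow_const (p := 3 / 2) (Or.inr (by norm_num))).fun_mul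
      (hasDerivAt_zpow k x (Or.inl hx0))
    refine h2.congr_deriv ?_
    have h3 : (4 * l - (x - (1 + l)) ^ 2) ^ (3 / 2 : ℝ) =
        (4 * l - (x - (1 + l)) ^ 2) * Real.sqrt (4 * l - (x - (1 + l)) ^ 2) := by
      rw [Real.sqrt_eq_rpow, show (3 / 2 : ℝ) = 1 + 1 / 2 by norm_num,
        Real.rpow_add_of_nonneg hq (by norm_num) (by norm_num), Real.rpow_one]
    rw [h3, show (3 / 2 - 1 : ℝ) = 1 / 2 by norm_num, ← Real.sqrt_eq_rpow, zpow_add_one₀ hx0,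
      zpow_sub_one₀ hx0]
    field_simp
    ring
  have h := intervalIntegral.integral_eq_sub_of_hasDerivAt hder
    (((hinteg _ _).add (hinteg _ _)).sub (hinteg _ _))
  rw [intervalIntegral.integral_sub ((hinteg _ _).add (hinteg _ _)) (hinteg _ _),
    intervalIntegral.integral_add (hinteg _ _) (hinteg _ _), intervalIntegral.integral_const_mul,
    intervalIntegral.integral_const_mul, intervalIntegral.integral_const_mul] at h
  rw [mpInt, mpInt, mpInt, h, mp_quadratic hl, mp_quadratic hl]
  simp

theorem mpInt_zero (hl : 1 < l) : mpInt l 0 = 2 * Real.pi * l := by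
  have hs : 0 < Real.sqrt l := Real.sqrt_pos.2 (by linarith)
  have h := Real.sq_sqrt (by linarith : 0 ≤ l)
  have h1 := intervalIntegral.mul_integral_comp_mul_add (a := -1) (b := 1)
    (f := fun x => Real.sqrt (4 * l - (x - (1 + l)) ^ 2)) (2 * Real.sqrt l) (1 + l)
  rw [show 2 * Real.sqrt l * -1 + (1 + l) = mpLeft l by rw [mpLeft]; ring,
    show 2 * Real.sqrt l * 1 + (1 + l) = mpRight l by rw [mpRight]; ring] at h1
  have h2 : ∀ x : ℝ, Real.sqrt (4 * l - (2 * Real.sqrt l * x + (1 + l) - (1 + l)) ^ 2) =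
      2 * Real.sqrt l * Real.sqrt (1 - x ^ 2) := by
    intro x
    rw [show 4 * l - (2 * Real.sqrt l * x + (1 + l) - (1 + l)) ^ 2 =
        (2 * Real.sqrt l) ^ 2 * (1 - x ^ 2) by
      linear_combination (-4) * h, Real.sqrt_mul (sq_nonneg _), Real.sqrt_sq (by positivity)]
  simp only [h2] at h1
  rw [intervalIntegral.integral_const_mul, integral_sqrt_one_sub_sq] at h1
  simp only [mpInt, zpow_zero, mul_one]
  rw [← h1]
  linear_combination 2 * Real.pi * h

theorem integral_freePoissonMeasure_one (hl : 1 < l) :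
    ∫ t, t ^ (1 : ℤ) ∂freePoissonMeasure l 1 = l := by
  rw [integral_freePoissonMeasure_zpow hl, sub_self, mpInt_zero hl]
  field_simp

theorem integral_freePoissonMeasure_two (hl : 1 < l) :
    ∫ t, t ^ (2 : ℤ) ∂freePoissonMeasure l 1 = l + l ^ 2 := by
  have h := mpInt_recurrence hl 0
  rw [integral_freePoissonMeasure_zpow hl]
  norm_num [mpInt_zero hl] at h ⊢
  field_simp
  linear_combination (-1 / 3) * h

theorem integral_freePoissonMeasure_neg_one (hl : 1 < l)
    (h1 : ∫ t, t ^ (0 : ℤ) ∂freePoissonMeasure l 1 = 1) :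
    ∫ t, t ^ (-1 : ℤ) ∂freePoissonMeasure l 1 = 1 / (l - 1) := by
  have hl1 : l - 1 ≠ 0 := by linarith
  have h := mpInt_recurrence hl (-1)
  rw [integral_freePoissonMeasure_zpow hl] at h1 ⊢
  rw [div_eq_one_iff_eq (by positivity)] at h1
  norm_num [mpInt_zero hl] at h h1 ⊢
  rw [h1] at h
  rw [div_eq_iff (by positivity)]
  field_simp
  refine mul_right_cancel₀ hl1 ?_
  linear_combination h

theorem integral_freePoissonMeasure_neg_two (hl : 1 < l)
    (h1 : ∫ t, t ^ (0 : ℤ) ∂freePoissonMeasure l 1 = 1) :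
    ∫ t, t ^ (-2 : ℤ) ∂freePoissonMeasure l 1 = l / (l - 1) ^ 3 := by
  have hl1 : l - 1 ≠ 0 := by linarith
  have h := mpInt_recurrence hl (-2)
  have h2 := integral_freePoissonMeasure_neg_one hl h1
  rw [integral_freePoissonMeasure_zpow hl] at h1 h2 ⊢
  rw [div_eq_iff (by positivity)] at h1 h2
  norm_num at h h1 h2 ⊢
  rw [h1, h2] at h
  rw [div_eq_iff (by positivity)]
  field_simp at h
  field_simp
  linear_combination (1 / 2) * h

theorem integral_freePoissonMeasure_neg_three (hl : 1 < l)
    (h1 : ∫ t, t ^ (0 : ℤ) ∂freePoissonMeasure l 1 = 1) :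
    ∫ t, t ^ (-3 : ℤ) ∂freePoissonMeasure l 1 = l * (l + 1) / (l - 1) ^ 5 := by
  have hl1 : l - 1 ≠ 0 := by linarith
  have h := mpInt_recurrence hl (-3)
  have h2 := integral_freePoissonMeasure_neg_two hl h1
  rw [integral_freePoissonMeasure_zpow hl] at h2 ⊢
  rw [div_eq_iff (by positivity)] at h2
  norm_num at h h2 ⊢
  rw [h2] at h
  rw [div_eq_iff (by positivity)]
  field_simp at h
  field_simp
  linear_combination (1 / 3) * h

end MarchenkoPastur

section Spectral

open MeasureTheory

variable {A : Type*} [CStarAlgebra A]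

theorem IsState.exists_real_of_nonneg [PartialOrder A] [StarOrderedRing A]
    {φ : A →ₗ[ℂ] ℂ} (hst : IsState φ) {a : A} (ha : 0 ≤ a) :
    ∃ r : ℝ, 0 ≤ r ∧ φ a = r := by
  obtain ⟨b, rfl⟩ := CStarAlgebra.nonneg_iff_eq_star_mul_self.1 ha
  exact hst.2 b

theorem IsState.map_algebraMap {φ : A →ₗ[ℂ] ℂ} (hst : IsState φ) (r : ℝ) :
    φ (algebraMap ℝ A r) = r := by
  rw [IsScalarTower.algebraMap_apply ℝ ℂ A, Algebra.algebraMap_eq_smul_one, map_smul, hst.1]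
  simp

theorem IsState.norm_map_le_of_isSelfAdjoint [PartialOrder A] [StarOrderedRing A]
    {φ : A →ₗ[ℂ] ℂ} (hst : IsState φ) {a : A}
    (ha : IsSelfAdjoint a) : ‖φ a‖ ≤ ‖a‖ := by
  obtain ⟨r, hr, h1⟩ := hst.exists_real_of_nonneg (sub_nonneg.2 ha.le_algebraMap_norm_self)
  obtain ⟨s, hs, h2⟩ := hst.exists_real_of_nonneg
    (sub_nonneg.2 ha.neg_algebraMap_norm_le_self)
  rw [map_sub, hst.map_algebraMap] at h1
  rw [map_sub, map_neg, hst.map_algebraMap] at h2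
  have h3 : φ a = ((‖a‖ - r : ℝ) : ℂ) := by
    push_cast
    linear_combination -h1
  have h4 : φ a = ((s - ‖a‖ : ℝ) : ℂ) := by
    push_cast
    linear_combination h2
  have h5 : ‖a‖ - r = s - ‖a‖ := Complex.ofReal_injective (h3.symm.trans h4)
  rw [h3, Complex.norm_real, Real.norm_eq_abs, abs_le]
  constructor <;> linarith

theorem IsState.norm_map_le [PartialOrder A] [StarOrderedRing A] {φ : A →ₗ[ℂ] ℂ}
    (hst : IsState φ) (a : A) : ‖φ a‖ ≤ 2 * ‖a‖ := by
  have h1 := hst.norm_map_le_of_isSelfAdjoint (realPart a).2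
  have h2 := hst.norm_map_le_of_isSelfAdjoint (imaginaryPart a).2
  have h3 : ‖(realPart a : A)‖ ≤ ‖a‖ := realPart.norm_le a
  have h4 : ‖(imaginaryPart a : A)‖ ≤ ‖a‖ := imaginaryPart.norm_le a
  calc ‖φ a‖ = ‖φ (realPart a : A) + Complex.I * φ (imaginaryPart a : A)‖ := by
        conv_lhs => rw [← realPart_add_I_smul_imaginaryPart a]
        rw [map_add, map_smul, smul_eq_mul]
    _ ≤ ‖φ (realPart a : A)‖ + ‖φ (imaginaryPart a : A)‖ := by
        refine (norm_add_le _ _).trans_eq ?_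
        rw [norm_mul, Complex.norm_I, one_mul]
    _ ≤ 2 * ‖a‖ := by linarith

theorem map_aeval_eq_integral (ψ : A →ₗ[ℂ] ℂ) {Z : A} {μ : Measure ℝ}
    (hinteg : ∀ r : ℕ, Integrable (fun t => t ^ r) μ)
    (hm : ∀ r : ℕ, ψ (Z ^ r) = ((∫ t, t ^ r ∂μ : ℝ) : ℂ)) (p : Polynomial ℝ) :
    Integrable (fun t => p.eval t) μ ∧
      ψ (Polynomial.aeval Z p) = ((∫ t, p.eval t ∂μ : ℝ) : ℂ) := by
  induction p using Polynomial.induction_on' with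
  | add p q hp hq =>
    simp only [Polynomial.eval_add, map_add]
    refine ⟨hp.1.add hq.1, ?_⟩
    rw [integral_add hp.1 hq.1, hp.2, hq.2, Complex.ofReal_add]
  | monomial n c =>
    simp only [Polynomial.eval_monomial, Polynomial.aeval_monomial]
    refine ⟨(hinteg n).const_mul c, ?_⟩
    rw [integral_const_mul, IsScalarTower.algebraMap_apply ℝ ℂ A, ← Algebra.smul_def, map_smul,
      hm, Complex.ofReal_mul]
    rfl

theorem map_cfc_eq_integral {ψ : A →ₗ[ℂ] ℂ} {C : ℝ} (hC : 0 ≤ C)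
    (hψ : ∀ x, ‖ψ x‖ ≤ C * ‖x‖) {Z : A}
    (hZ : IsSelfAdjoint Z) {a b : ℝ} (hsp : spectrum ℝ Z ⊆ Set.Icc a b) {μ : Measure ℝ}
    [IsFiniteMeasure μ] (hμ : ∀ᵐ t ∂μ, t ∈ Set.Icc a b)
    (hm : ∀ r : ℕ, ψ (Z ^ r) = ((∫ t, t ^ r ∂μ : ℝ) : ℂ)) {g : ℝ → ℝ}
    (hg : ContinuousOn g (Set.Icc a b)) : ψ (cfc g Z) = ((∫ t, g t ∂μ : ℝ) : ℂ) := by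
  have hinteg : ∀ {f : ℝ → ℝ}, ContinuousOn f (Set.Icc a b) → Integrable f μ := by
    intro f hf
    rw [← Measure.restrict_eq_self_of_ae_mem hμ]
    exact hf.integrableOn_Icc
  have hpoly := map_aeval_eq_integral ψ (fun r => hinteg (continuous_pow r).continuousOn) hm
  have hgs : ContinuousOn g (spectrum ℝ Z) := hg.mono hsp
  have key : ∀ ε > 0, ‖ψ (cfc g Z) - ((∫ t, g t ∂μ : ℝ) : ℂ)‖ ≤ (C + μ.real Set.univ) * ε := by
    intro ε hε
    obtain ⟨p, hp⟩ := exists_polynomial_near_of_continuousOn a b g hg ε hε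
    obtain ⟨hpi, hpe⟩ := hpoly p
    have h1 : ‖ψ (cfc (fun t => g t - p.eval t) Z)‖ ≤ C * ε := by
      refine (hψ _).trans (mul_le_mul_of_nonneg_left (norm_cfc_le hε.le fun x hx => ?_) hC)
      rw [Real.norm_eq_abs, abs_sub_comm]
      exact (hp x (hsp hx)).le
    have h2 : ‖∫ t, (p.eval t - g t) ∂μ‖ ≤ ε * μ.real Set.univ :=
      norm_integral_le_of_norm_le_const (hμ.mono fun t ht => (hp t ht).le)
    rw [cfc_sub g (fun t => p.eval t) Z hgs p.continuous.continuousOn, cfc_polynomial p Z hZ,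
      map_sub, hpe] at h1
    rw [integral_sub hpi (hinteg hg), ← Complex.norm_real, Complex.ofReal_sub] at h2
    calc _ = ‖(ψ (cfc g Z) - ((∫ t, p.eval t ∂μ : ℝ) : ℂ)) +
          (((∫ t, p.eval t ∂μ : ℝ) : ℂ) - ((∫ t, g t ∂μ : ℝ) : ℂ))‖ := by
          congr 1
          ring
      _ ≤ _ := norm_add_le _ _
      _ ≤ _ := by linarith
  have hM : 0 < C + μ.real Set.univ + 1 := by positivity
  rw [← sub_eq_zero, ← norm_le_zero_iff]
  refine le_of_forall_pos_le_add fun δ hδ => ?_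
  refine (key (δ / (C + μ.real Set.univ + 1)) (by positivity)).trans ?_
  rw [zero_add, mul_div_assoc', div_le_iff₀ hM]
  nlinarith

theorem exists_Icc_of_isCompact {K : Set ℝ} (hK : IsCompact K) (h : ∀ x ∈ K, 0 < x) {c d : ℝ}
    (hc : 0 < c) : ∃ a b, 0 < a ∧ a ≤ c ∧ d ≤ b ∧ K ⊆ Set.Icc a b := by
  obtain ⟨a, ha⟩ := (hK.insert c).exists_isLeast ⟨c, by simp⟩
  obtain ⟨b, hb⟩ := (hK.insert d).exists_isGreatest ⟨d, by simp⟩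
  refine ⟨a, b, ?_, ha.2 (by simp), hb.2 (by simp), fun x hx =>
    ⟨ha.2 (by simp [hx]), hb.2 (by simp [hx])⟩⟩
  rcases ha.1 with h1 | h1
  · rwa [h1]
  · exact h a h1

theorem map_zpow_eq_integral [PartialOrder A] [StarOrderedRing A] {ψ : A →ₗ[ℂ] ℂ} {C : ℝ}
    (hC : 0 ≤ C) (hψ : ∀ x, ‖ψ x‖ ≤ C * ‖x‖) {u : Aˣ} (hu : 0 ≤ (u : A)) {c d : ℝ} (hc : 0 < c)
    {μ : Measure ℝ} [IsFiniteMeasure μ] (hμ : ∀ᵐ t ∂μ, t ∈ Set.Icc c d)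
    (hm : ∀ r : ℕ, ψ ((u : A) ^ r) = ((∫ t, t ^ r ∂μ : ℝ) : ℂ)) (k : ℤ) :
    ψ ((u ^ k : Aˣ) : A) = ((∫ t, t ^ k ∂μ : ℝ) : ℂ) := by
  have hsa : IsSelfAdjoint (u : A) := .of_nonneg hu
  obtain ⟨a, b, ha, hac, hdb, hab⟩ := exists_Icc_of_isCompact (d := d)
    (ContinuousFunctionalCalculus.isCompact_spectrum (R := ℝ) (u : A)) (fun x hx =>
      (spectrum_nonneg_of_nonneg hu hx).lt_of_ne fun h =>
        spectrum.zero_notMem ℝ u.isUnit (h ▸ hx)) hc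
  rw [← cfc_zpow (R := ℝ) u k hsa]
  refine map_cfc_eq_integral hC hψ hsa hab
    (hμ.mono fun t ht => ⟨hac.trans ht.1, ht.2.trans hdb⟩) hm fun x hx =>
      (continuousAt_zpow₀ x k (Or.inl (ha.trans_le hx.1).ne')).continuousWithinAt

end Spectral

section Lukacs

open MeasureTheory

theorem ae_mem_Icc_freePoissonMeasure {l : ℝ} (hl : 1 < l) :
    ∀ᵐ t ∂freePoissonMeasure l 1, t ∈ Set.Icc (mpLeft l) (mpRight l) := by
  have hmeas : Measurable (freePoissonDensity l 1) := by
    unfold freePoissonDensity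
    fun_prop
  rw [freePoissonMeasure, max_eq_left (by linarith), ENNReal.ofReal_zero, zero_smul, zero_add,
    ae_withDensity_iff hmeas.ennreal_ofReal]
  refine .of_forall fun t ht => ?_
  by_contra hmem
  have h := Real.sqrt_eq_zero_of_nonpos (mp_quadratic_nonpos hl hmem)
  exact ht (by simp [freePoissonDensity, h])

theorem HasMoments.integral_freePoissonMeasure_zero [Ring A] [StarRing A] [Module ℂ A]
    {φ : A →ₗ[ℂ] ℂ} (hst : IsState φ) {Z : A} {l : ℝ}
    (hm : HasMoments (⇑φ) Z (freePoissonMeasure l 1)) :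
    ∫ t, t ^ (0 : ℤ) ∂freePoissonMeasure l 1 = 1 := by
  have h := hm 0
  rw [pow_zero, hst.1] at h
  exact_mod_cast h.symm

theorem HasMoments.map_inv_zpow [CStarAlgebra A] [PartialOrder A] [StarOrderedRing A]
    {φ : A →ₗ[ℂ] ℂ} (hst : IsState φ) {u : Aˣ} (hu : 0 ≤ (u : A)) {l : ℝ} (hl : 1 < l)
    (hm : HasMoments (⇑φ) ((u⁻¹ : Aˣ) : A) (freePoissonMeasure l 1)) (k : ℤ) :
    φ ((u⁻¹ ^ k : Aˣ) : A) = ((∫ t, t ^ k ∂freePoissonMeasure l 1 : ℝ) : ℂ) := by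
  have h0 := hm.integral_freePoissonMeasure_zero hst
  have : IsFiniteMeasure (freePoissonMeasure l 1) := by
    by_contra h
    rw [not_isFiniteMeasure_iff] at h
    simp [Measure.real, h] at h0
  have hu' : 0 ≤ ((u⁻¹ : Aˣ) : A) := by
    have hsa : IsSelfAdjoint ((u⁻¹ : Aˣ) : A) := by
      have h : star u = u := Units.ext (IsSelfAdjoint.of_nonneg hu)
      rw [IsSelfAdjoint, ← Units.coe_star, star_inv, h]
    simpa [hsa.star_eq] using star_left_conjugate_nonneg hu ((u⁻¹ : Aˣ) : A)
  exact map_zpow_eq_integral zero_le_two hst.norm_map_le hu' (mpLeft_pos hl)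
    (ae_mem_Icc_freePoissonMeasure hl) hm k

theorem cumulant_two_lukacs [Ring A] [Module ℂ A] {φ : A →ₗ[ℂ] ℂ}
    {R : ∀ n, (Fin n → A) → ℂ} (hone : φ 1 = 1) (htr : Tracial φ) (hmc : MomentCumulant (⇑φ) R)
    {X Y Z : A} {S T : Set A} (hX : X ∈ S) (hZ : Z ∈ S) (hY : Y ∈ T) (hST : MixedVanish R S T)
    (hXZ : X * Z = 1) (hZX : Z * X = 1) (hXY : φ X = φ Y) :
    R 2 ![(1 + Y * Z) * (1 + Z * Y), X + Y] =
      φ (Z * Z) * φ (Y ^ 3) + 2 * φ Z * φ (Y ^ 2) + 2 * φ Y - 3 * φ Z * φ Y ^ 2 +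
        φ (Z * Z) * φ Y * (φ (Y ^ 2) - φ Y ^ 2) - 2 * φ Y * φ (Z * Z) * φ (Y ^ 2) := by
  have hp := hmc.map_pow_mul_pow hST hZ hY
  have e1 : φ (Y * Z) = φ Z * φ Y := by
    rw [htr]
    simpa using hp 1 1
  have e2 : φ (Z * Y) = φ Z * φ Y := by simpa using hp 1 1
  have e3 : φ (Y * Z * (Z * Y)) = φ (Z * Z) * φ (Y ^ 2) := by
    rw [mul_assoc, htr, ← pow_two Z, ← hp 2 2]
    congr 1
    noncomm_ring
  have e4 : φ (Y * Z * Y) = φ Z * φ (Y ^ 2) := by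
    rw [mul_assoc, htr]
    simpa [pow_two, mul_assoc] using hp 1 2
  have e5 : φ (Z * Y * X) = φ Y := by
    rw [htr, ← mul_assoc, hXZ, one_mul]
  have e6 : φ (Z * Y * Y) = φ Z * φ (Y ^ 2) := by
    simpa [pow_two, mul_assoc] using hp 1 2
  have e7 : φ (Y * Z * (Z * Y) * X) = φ Y * φ Y * φ Z +
      (φ (Y ^ 2) - φ Y * φ Y) * (φ Y * φ (Z * Z)) := by
    have h := hmc.map_five hST hX hY hZ hZ hY
    rw [← mul_assoc X Z Z, hXZ, one_mul, hXY, ← pow_two Y] at h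
    rw [htr, ← h]
    simp only [mul_assoc]
  have e8 : φ (Y * Z * (Z * Y) * Y) = φ (Z * Z) * φ (Y ^ 3) := by
    rw [mul_assoc, mul_assoc, htr, ← pow_two Z, ← hp 2 3]
    congr 1
    noncomm_ring
  have e9 : φ (Y * Z * X) = φ Y := by rw [mul_assoc, hZX, mul_one]
  have hT : (1 + Y * Z) * (1 + Z * Y) = 1 + Z * Y + Y * Z + Y * Z * (Z * Y) := by noncomm_ring
  rw [hmc.cumulant_two, hT]
  simp only [mul_add, add_mul, one_mul, map_add, hone, e1, e2, e3, e4, e5, e6, e7, e8, e9, hXY]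
  ring

theorem not_freeElems_of_cumulant_ne_zero [CStarAlgebra A] [PartialOrder A] [StarOrderedRing A]
    {φ : A →ₗ[ℂ] ℂ} {R : ∀ n, (Fin n → A) → ℂ} (hst : IsState φ) (hmc : MomentCumulant (⇑φ) R)
    {s : A} {d : Aˣ} (hd : 0 ≤ (d : A))
    (h : φ (s * ((d⁻¹ : Aˣ) : A)) ≠ φ s * φ ((d⁻¹ : Aˣ) : A)) : ¬ FreeElems R s d := by
  intro hfree
  let ψ : A →ₗ[ℂ] ℂ := φ ∘ₗ LinearMap.mulLeft ℂ s - φ s • φ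
  have hψ : ∀ x, ‖ψ x‖ ≤ (2 * ‖s‖ + ‖φ s‖ * 2) * ‖x‖ := by
    intro x
    calc ‖ψ x‖ ≤ ‖φ (s * x)‖ + ‖φ s * φ x‖ := norm_sub_le _ _
      _ ≤ 2 * (‖s‖ * ‖x‖) + ‖φ s‖ * (2 * ‖x‖) := by
          rw [norm_mul]
          gcongr
          · exact (hst.norm_map_le _).trans (by gcongr; exact norm_mul_le _ _)
          · exact hst.norm_map_le _
      _ = _ := by ring
  have hz := map_zpow_eq_integral (by positivity) hψ hd (c := 1) (d := 1) one_pos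
    (μ := 0) (by simp) (fun r => ?_) (-1)
  · refine h (sub_eq_zero.1 ?_)
    simpa [ψ] using hz
  · have := hmc.map_pow_mul_pow hfree (Set.mem_singleton s) (Set.mem_singleton (d : A)) 1 r
    rw [pow_one] at this
    simp [ψ, this]

end Lukacs

/-- for `X, Y` free, identically distributed with free Gamma distribution
(`X⁻¹` free Poisson with rate `l > 1`, jump size 1, `X` positive), `X + Y` and
`(X+Y)⁻¹ X² (X+Y)⁻¹` are NOT free; more precisely
`R_2((1 + YX⁻¹)(1 + X⁻¹Y), X + Y) = 4l²/(l−1)⁵ + 2(2l−1)/(l−1)⁴ ≠ 0`. -/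
theorem free_gamma_not_lukacs
    {A : Type*} [NormedRing A] [StarRing A] [CStarRing A] [CompleteSpace A]
    [NormedAlgebra ℂ A] [StarModule ℂ A] [PartialOrder A] [StarOrderedRing A]
    (φ : A →ₗ[ℂ] ℂ) (R : ∀ n, (Fin n → A) → ℂ)
    (hst : IsState φ) (hfa : Faithful φ) (htr : Tracial φ)
    (hmc : MomentCumulant (⇑φ) R)
    (X Y : A) (hXsa : IsSelfAdjoint X) (hYsa : IsSelfAdjoint Y)
    (hXpos : 0 ≤ X) (hUX : IsUnit X) (hUY : IsUnit Y) (hUXY : IsUnit (X + Y))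
    (l : ℝ) (hl : 1 < l)
    (hmomX : HasMoments (⇑φ) (Ring.inverse X) (freePoissonMeasure l 1))
    (hmomY : HasMoments (⇑φ) (Ring.inverse Y) (freePoissonMeasure l 1))
    (hid : ∀ r : ℕ, φ (X ^ r) = φ (Y ^ r))
    (hfree : MixedVanish R ({X, Ring.inverse X} : Set A) ({Y, Ring.inverse Y} : Set A)) :
    R 2 ![(1 + Y * Ring.inverse X) * (1 + Ring.inverse X * Y), X + Y] =
        4 * (l : ℂ) ^ 2 / ((l : ℂ) - 1) ^ 5 + 2 * (2 * (l : ℂ) - 1) / ((l : ℂ) - 1) ^ 4 ∧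
      4 * (l : ℂ) ^ 2 / ((l : ℂ) - 1) ^ 5 + 2 * (2 * (l : ℂ) - 1) / ((l : ℂ) - 1) ^ 4 ≠ 0 ∧
      ¬ FreeElems R (X + Y)
          (Ring.inverse (X + Y) * X ^ 2 * Ring.inverse (X + Y)) := by
  let _ : CStarAlgebra A := { }
  have hne : 4 * (l : ℂ) ^ 2 / ((l : ℂ) - 1) ^ 5 + 2 * (2 * (l : ℂ) - 1) / ((l : ℂ) - 1) ^ 4
      ≠ 0 := by
    have h1 : 0 < l - 1 := by linarith
    have h2 : 0 < 2 * l - 1 := by linarith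
    have h3 : 0 < 4 * l ^ 2 / (l - 1) ^ 5 + 2 * (2 * l - 1) / (l - 1) ^ 4 := by positivity
    exact_mod_cast h3.ne'
  obtain ⟨u, rfl⟩ := hUX
  obtain ⟨s, hs⟩ := hUXY
  rw [← hs, Ring.inverse_unit, Ring.inverse_unit]
  rw [Ring.inverse_unit] at hmomX hfree
  have h0 := hmomX.integral_freePoissonMeasure_zero hst
  have hx1 : φ (u : A) = 1 / ((l : ℂ) - 1) := by
    have h := hmomX.map_inv_zpow hst hXpos hl (-1)
    rw [integral_freePoissonMeasure_neg_one hl h0] at h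
    simpa using h
  have hx2 : φ ((u : A) ^ 2) = l / ((l : ℂ) - 1) ^ 3 := by
    have h := hmomX.map_inv_zpow hst hXpos hl (-2)
    rw [integral_freePoissonMeasure_neg_two hl h0, inv_zpow', neg_neg] at h
    exact_mod_cast h
  have hx3 : φ ((u : A) ^ 3) = l * (l + 1) / ((l : ℂ) - 1) ^ 5 := by
    have h := hmomX.map_inv_zpow hst hXpos hl (-3)
    rw [integral_freePoissonMeasure_neg_three hl h0, inv_zpow', neg_neg] at h
    exact_mod_cast h
  have hz1 : φ ((u⁻¹ : Aˣ) : A) = l := by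
    have h := hmomX.map_inv_zpow hst hXpos hl 1
    rw [integral_freePoissonMeasure_one hl] at h
    simpa using h
  have hz2 : φ (((u⁻¹ : Aˣ) : A) * ((u⁻¹ : Aˣ) : A)) = l + l ^ 2 := by
    have h := hmomX.map_inv_zpow hst hXpos hl 2
    rw [integral_freePoissonMeasure_two hl, zpow_two, Units.val_mul] at h
    exact_mod_cast h
  have hy1 : φ (u : A) = φ Y := by simpa using hid 1
  have hR := cumulant_two_lukacs hst.1 htr hmc (Or.inl rfl) (Or.inr rfl) (Or.inl rfl) hfree
    u.mul_inv u.inv_mul hy1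
  have hl1 : (l : ℂ) - 1 ≠ 0 := by
    exact_mod_cast (by linarith : l - 1 ≠ 0)
  rw [← hid 2, ← hid 3, ← hy1, hx1, hx2, hx3, hz1, hz2, ← hs] at hR
  have hval : R 2 ![(1 + Y * ((u⁻¹ : Aˣ) : A)) * (1 + ((u⁻¹ : Aˣ) : A) * Y), (s : A)] =
      4 * (l : ℂ) ^ 2 / ((l : ℂ) - 1) ^ 5 + 2 * (2 * (l : ℂ) - 1) / ((l : ℂ) - 1) ^ 4 := by
    rw [hR]
    field_simp
    ring
  refine ⟨hval, hne, ?_⟩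
  have hsu : (s : A) * ((u⁻¹ : Aˣ) : A) = 1 + Y * ((u⁻¹ : Aˣ) : A) := by
    rw [hs, add_mul, u.mul_inv]
  have hus : ((u⁻¹ : Aˣ) : A) * s = 1 + ((u⁻¹ : Aˣ) : A) * Y := by
    rw [hs, mul_add, u.inv_mul]
  have hd : ((s⁻¹ : Aˣ) : A) * (u : A) ^ 2 * ((s⁻¹ : Aˣ) : A) =
      ((s⁻¹ * u ^ 2 * s⁻¹ : Aˣ) : A) := by
    simp
  have hsinv : star s⁻¹ = s⁻¹ := by
    have h : star s = s := Units.ext (by rw [Units.coe_star, hs, star_add, hXsa, hYsa])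
    rw [star_inv, h]
  have hustar : star u = u := Units.ext hXsa
  rw [hd]
  refine not_freeElems_of_cumulant_ne_zero hst hmc ?_ ?_
  · have h : (s⁻¹ * u ^ 2 * s⁻¹ : Aˣ) = s⁻¹ * u * star (s⁻¹ * u) := by
      rw [star_mul, hsinv, hustar, pow_two]
      simp only [mul_assoc]
    rw [h, Units.val_mul, Units.coe_star]
    exact mul_star_self_nonneg _
  · have h : (((s⁻¹ * u ^ 2 * s⁻¹)⁻¹ : Aˣ) : A) =
        (1 + Y * ((u⁻¹ : Aˣ) : A)) * (1 + ((u⁻¹ : Aˣ) : A) * Y) := by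
      rw [← hsu, ← hus]
      simp only [← Units.val_mul]
      congr 1
      group
    intro heq
    rw [h, htr, mul_comm (φ (s : A)), ← sub_eq_zero, ← hmc.cumulant_two, hval] at heq
    exact hne heq

end FreeProbLukacs
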